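/- Let n be a positive integer partitioned into J blocks, and let Λ be an invertible n × n real matrix whose diagonal blocks Λ_{jj} are each invertible. Let D denote the block-diagonal matrix whose (j,j) block is Λ_{jj} and whose off-diagonal blocks are zero, let V := D^{-1} (the block-diagonal matrix with blocks Λ_{jj}^{-1}), and let H := D − Λ (the negative of the off-block-diagonal part of Λ). Then I − V H is invertible and (I − V H)^{-1} V = Λ^{-1}. -/

import Mathlib

open Matrix

theorem Matrix.isUnit_blockDiagonal' {o R : Type*} {m : o → Type*} [Fintype o] [DecidableEq o]
    [∀ j, Fintype (m j)] [∀ j, DecidableEq (m j)] [CommRing R]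
    (M : ∀ j, Matrix (m j) (m j) R) (hM : ∀ j, IsUnit (M j)) :
    IsUnit (Matrix.blockDiagonal' M) :=
  (Pi.isUnit_iff.mpr hM).map (Matrix.blockDiagonal'RingHom m R)

/-- **LRVB is exact for multivariate normal posteriors.**
Index `n = ∑ j, d j` by pairs `⟨j, a⟩`. Let `Λ` be an invertible matrix with invertible diagonal
blocks `Λ_{jj}`, let `D` be the block-diagonal matrix of the `Λ_{jj}`, let `V := D⁻¹` and
`H := D − Λ`. Then `I − V H` is invertible and `(I − V H)⁻¹ V = Λ⁻¹`. -/
theorem lrvb_exact_for_multivariate_normal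
    (J : ℕ) (hJ : 0 < J) (d : Fin J → ℕ) (hd : ∀ j, 0 < d j)
    (Λ : Matrix ((j : Fin J) × Fin (d j)) ((j : Fin J) × Fin (d j)) ℝ)
    (hΛ : IsUnit Λ.det)
    (hdiag : ∀ j : Fin J,
      IsUnit (Matrix.of (fun a b : Fin (d j) => Λ ⟨j, a⟩ ⟨j, b⟩)).det)
    (D : Matrix ((j : Fin J) × Fin (d j)) ((j : Fin J) × Fin (d j)) ℝ)
    (hD : D = Matrix.of (fun i i' : (j : Fin J) × Fin (d j) =>
      if i.1 = i'.1 then Λ i i' else 0))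
    (V H : Matrix ((j : Fin J) × Fin (d j)) ((j : Fin J) × Fin (d j)) ℝ)
    (hV : V = D⁻¹) (hH : H = D - Λ) :
    IsUnit (1 - V * H).det ∧ (1 - V * H)⁻¹ * V = Λ⁻¹ := by
  have hD' : D = Matrix.blockDiagonal'
      (fun j => Matrix.of (fun a b : Fin (d j) => Λ ⟨j, a⟩ ⟨j, b⟩)) := by
    rw [hD]
    ext ⟨j, a⟩ ⟨k, b⟩
    by_cases h : j = k
    · subst h
      simp
    · simp [Matrix.blockDiagonal'_apply_ne, h]
  have hDu : IsUnit D.det := by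
    rw [← Matrix.isUnit_iff_isUnit_det, hD']
    exact Matrix.isUnit_blockDiagonal' _ fun j => (Matrix.isUnit_iff_isUnit_det _).mpr (hdiag j)
  have hVΛ : 1 - V * H = D⁻¹ * Λ := by
    rw [hV, hH, mul_sub, Matrix.nonsing_inv_mul D hDu, sub_sub_cancel]
  rw [hVΛ, hV]
  refine ⟨?_, ?_⟩
  · rw [Matrix.det_mul]
    exact (Matrix.isUnit_nonsing_inv_det D hDu).mul hΛ
  · rw [Matrix.mul_inv_rev, Matrix.nonsing_inv_nonsing_inv D hDu, mul_assoc,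
      Matrix.mul_nonsing_inv D hDu, mul_one]
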